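/- Fix a totally real number field K₀ of class number one and degree N over ℚ, and let 0 < σ < 1. Let φ be an even Schwartz function on ℝ whose Fourier transform φ̂ is supported in (−σ, σ). For a CM-field K with maximal totally real subfield K₀, class number h_K, and Δ = Δ_K, define S_{2,1}(Δ, φ)₂ = −2 · ∑_𝔭 log N𝔭 · ∑_{m ≥ 1, gcd(m, h_K) = 1} φ̂(m·log N𝔭 / log Δ) / N𝔭^{m/2}, where the outer sum runs over the principal prime ideals 𝔭 of O_K whose absolute norm is the square of a rational prime. Then there is a constant C > 0 (depending only on K₀ and φ) such that for every such CM-field K with Δ_K ≥ 16, |S_{2,1}(Δ, φ)₂ + 4 · ∑_𝔮 (log N𝔮 / N𝔮) · φ̂(2·log N𝔮 / log Δ)| ≤ C · log log Δ, where the last sum runs over the prime ideals 𝔮 of O_{K₀} that are inert in K and whose absolute norm is a rational prime. -/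

import Mathlib

open NumberField FourierTransform

/-- The sum `S_{2,1}(Δ, φ)₂ = −2·∑_𝔭 log N𝔭 · ∑_{m ≥ 1, (m, h_K) = 1}
φ̂(m·log N𝔭/log Δ)/N𝔭^{m/2}`, the outer sum running over the principal prime ideals of
`O_K` whose absolute norm is the square of a rational prime. -/
noncomputable def S21two.{v} (K : Type v) [Field K] [NumberField K]
    (φ : SchwartzMap ℝ ℂ) (Δ : ℝ) : ℂ :=
  (-2 : ℂ) * ∑' 𝔭 : {𝔭 : Ideal (𝓞 K) // 𝔭.IsPrime ∧ Submodule.IsPrincipal 𝔭 ∧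
      ∃ p : ℕ, p.Prime ∧ Ideal.absNorm 𝔭 = p ^ 2},
    (Real.log (Ideal.absNorm 𝔭.1) : ℂ) *
      ∑' m : {m : ℕ // 1 ≤ m ∧ Nat.Coprime m (NumberField.classNumber K)},
        𝓕 ⇑φ ((m : ℝ) * Real.log (Ideal.absNorm 𝔭.1) / Real.log Δ) /
          ((((Ideal.absNorm 𝔭.1 : ℝ) ^ (((m : ℕ) : ℝ) / 2)) : ℝ) : ℂ)

/-- At most `[L : ℚ]` prime ideals of `𝓞 L` have norm a positive power of a given prime `p`. -/
theorem card_primes_absNorm_eq_pow_le (L : Type*) [Field L] [NumberField L] {p : ℕ}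
    (hp : p.Prime) (T : Finset (Ideal (𝓞 L)))
    (hT : ∀ 𝔭 ∈ T, 𝔭.IsPrime ∧ ∃ k : ℕ, k ≠ 0 ∧ Ideal.absNorm 𝔭 = p ^ k) :
    T.card ≤ Module.finrank ℚ L := by
  have hdvd : ∏ 𝔭 ∈ T, 𝔭 ∣ Ideal.span {(p : 𝓞 L)} := by
    refine Finset.prod_primes_dvd _ (fun 𝔭 h𝔭 => ?_) fun 𝔭 h𝔭 => ?_
    · obtain ⟨hprime, k, hk, hnorm⟩ := hT 𝔭 h𝔭
      refine Ideal.prime_of_isPrime (fun h => ?_) hprime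
      rw [h, Ideal.absNorm_bot] at hnorm
      exact (pow_pos hp.pos k).ne hnorm
    · obtain ⟨hprime, k, hk, hnorm⟩ := hT 𝔭 h𝔭
      rw [Ideal.dvd_span_singleton]
      refine hprime.mem_of_pow_mem k ?_
      have := Ideal.absNorm_mem 𝔭
      rwa [hnorm, Nat.cast_pow] at this
  have hle : p ^ T.card ≤ p ^ Module.finrank ℚ L := by
    calc p ^ T.card = ∏ _𝔭 ∈ T, p := by simp
      _ ≤ ∏ 𝔭 ∈ T, Ideal.absNorm 𝔭 := by
          refine Finset.prod_le_prod' fun 𝔭 h𝔭 => ?_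
          obtain ⟨-, k, hk, hnorm⟩ := hT 𝔭 h𝔭
          rw [hnorm]
          exact Nat.le_self_pow hk p
      _ = Ideal.absNorm (∏ 𝔭 ∈ T, 𝔭) := (map_prod _ _ _).symm
      _ ≤ Ideal.absNorm (Ideal.span {(p : 𝓞 L)}) := by
          refine Nat.le_of_dvd ?_ (map_dvd _ hdvd)
          rw [Ideal.absNorm_span_natCast]
          exact pow_pos hp.pos _
      _ = p ^ Module.finrank ℚ L := by
          rw [Ideal.absNorm_span_natCast, RingOfIntegers.rank]
  exact (Nat.pow_le_pow_iff_right hp.one_lt).1 hle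

/-- A weight depending only on the residue characteristic `n 𝔭` sums over prime ideals to at most
`[L : ℚ]` times its sum over the rational primes. -/
theorem sum_primes_le_finrank_mul_tsum (L : Type*) [Field L] [NumberField L] {ι : Type*}
    (f : ι → Ideal (𝓞 L)) (hf : Function.Injective f) (n : ι → ℕ)
    (hn : ∀ i, (n i).Prime) (hprime : ∀ i, (f i).IsPrime)
    (hnorm : ∀ i, ∃ k : ℕ, k ≠ 0 ∧ Ideal.absNorm (f i) = n i ^ k)
    (w : ℕ → ℝ) (hw0 : ∀ m, 0 ≤ w m) (hw : Summable w) (T : Finset ι) :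
    ∑ i ∈ T, w (n i) ≤ Module.finrank ℚ L * ∑' m, w m := by
  classical
  have hmaps : ∀ i ∈ T, n i ∈ T.image n := fun i hi => Finset.mem_image_of_mem _ hi
  calc ∑ i ∈ T, w (n i)
      = ∑ q ∈ T.image n, ∑ i ∈ T with n i = q, w (n i) :=
        (Finset.sum_fiberwise_of_maps_to hmaps _).symm
    _ ≤ ∑ q ∈ T.image n, Module.finrank ℚ L * w q := by
        refine Finset.sum_le_sum fun q hq => ?_
        obtain ⟨j, -, rfl⟩ := Finset.mem_image.1 hq
        rw [Finset.sum_congr rfl (g := fun _ => w (n j))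
          (fun i hi => by rw [(Finset.mem_filter.1 hi).2]), Finset.sum_const, nsmul_eq_mul]
        refine mul_le_mul_of_nonneg_right ?_ (hw0 _)
        rw [Nat.cast_le, ← Finset.card_map ⟨f, hf⟩]
        refine card_primes_absNorm_eq_pow_le L (hn j) _ fun 𝔭 h𝔭 => ?_
        obtain ⟨i, hi, rfl⟩ := Finset.mem_map.1 h𝔭
        refine ⟨hprime i, ?_⟩
        rw [← (Finset.mem_filter.1 hi).2]
        exact hnorm i
    _ = Module.finrank ℚ L * ∑ q ∈ T.image n, w q := (Finset.mul_sum ..).symm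
    _ ≤ _ := by
        gcongr
        exact hw.sum_le_tsum _ fun m _ => hw0 m

section Discriminant

variable {K₀ K : Type*} [Field K₀] [NumberField K₀] [Field K] [NumberField K] [Algebra K₀ K]

theorem adjoin_singleton_eq_top_of_finrank_eq_two (h2 : Module.finrank K₀ K = 2) {x : K}
    (hx : x ∉ (algebraMap K₀ K).range) : Algebra.adjoin K₀ {x} = ⊤ := by
  have : Algebra.IsQuadraticExtension K₀ K := ⟨h2⟩
  have hprime : (Module.finrank K₀ K).Prime := h2 ▸ Nat.prime_two
  have hsimple := Subalgebra.isSimpleOrder_of_finrank_prime K₀ K hprime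
  refine (hsimple.eq_bot_or_eq_top _).resolve_left fun h => hx ?_
  have := Algebra.subset_adjoin (R := K₀) (Set.mem_singleton x)
  rw [h] at this
  exact Algebra.mem_bot.1 this

theorem norm_derivative_minpoly_le (hTR : ∀ ψ : K₀ →+* ℂ, ∀ z : K₀, (ψ z).im = 0)
    (h2 : Module.finrank K₀ K = 2) (hK : IsEmpty (K →+* ℝ)) {α : 𝓞 K}
    (hα : (α : K) ∉ (algebraMap K₀ K).range) (τ : K →+* ℂ) :
    ‖τ (Polynomial.aeval α (Polynomial.derivative (minpoly (𝓞 K₀) α)) : 𝓞 K)‖ ≤ 2 * ‖τ α‖ := by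
  have htop := adjoin_singleton_eq_top_of_finrank_eq_two h2 hα
  have hreal : ∀ x : K₀, (τ (algebraMap K₀ K x)).im = 0 := fun x =>
    hTR (τ.comp (algebraMap K₀ K)) x
  have him : (τ α).im ≠ 0 := by
    intro h0
    have hall : ∀ y : K, (τ y).im = 0 := by
      intro y
      have hy : y ∈ Algebra.adjoin K₀ {(α : K)} := htop ▸ Algebra.mem_top
      induction hy using Algebra.adjoin_induction with
      | mem x hx => rw [Set.mem_singleton_iff.1 hx, h0]
      | algebraMap r => exact hreal r
      | add x y _ _ hx hy => simp [hx, hy]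
      | mul x y _ _ hx hy => simp [hx, hy]
    have hτ : ComplexEmbedding.IsReal τ := by
      rw [ComplexEmbedding.isReal_iff]
      ext y
      exact Complex.conj_eq_iff_im.2 (hall y)
    exact hK.false hτ.embedding
  have hint : IsIntegral (𝓞 K₀) α := Algebra.IsIntegral.isIntegral α
  have hdeg : (minpoly (𝓞 K₀) α).natDegree = 2 := by
    rw [← h2, ← (minpoly.monic hint).natDegree_map (algebraMap (𝓞 K₀) K₀),
      ← minpoly.isIntegrallyClosed_eq_field_fractions K₀ K hint]
    have hpb := (Algebra.adjoin.powerBasis (K := K₀) (x := (α : K))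
      (Algebra.IsIntegral.isIntegral _)).finrank
    rw [Algebra.adjoin.powerBasis_dim] at hpb
    rw [show algebraMap (𝓞 K) K α = (α : K) from rfl, ← hpb, htop]
    exact Subalgebra.topEquiv.toLinearEquiv.finrank_eq
  set b := (minpoly (𝓞 K₀) α).coeff 1
  set c := (minpoly (𝓞 K₀) α).coeff 0
  have hpoly : minpoly (𝓞 K₀) α =
      Polynomial.X ^ 2 + Polynomial.C b * Polynomial.X + Polynomial.C c := by
    have := (minpoly.monic hint).as_sum
    rw [hdeg] at this
    rw [this, Finset.sum_range_succ, Finset.sum_range_one]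
    simp only [pow_zero, pow_one, mul_one]
    ring
  have hroot : (τ α) ^ 2 + τ (algebraMap K₀ K b) * τ α + τ (algebraMap K₀ K c) = 0 := by
    have h := minpoly.aeval (𝓞 K₀) α
    rw [hpoly] at h
    simp only [map_add, map_mul, map_pow, Polynomial.aeval_X, Polynomial.aeval_C] at h
    have h' := congrArg (fun y : 𝓞 K => τ (y : K)) h
    simp only [map_add, map_mul, map_pow, map_zero] at h'
    exact h'
  have hder : τ (Polynomial.aeval α (Polynomial.derivative (minpoly (𝓞 K₀) α)) : 𝓞 K) =
      2 * τ α + τ (algebraMap K₀ K b) := by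
    have h : Polynomial.aeval α (Polynomial.derivative (minpoly (𝓞 K₀) α)) =
        2 * α + algebraMap (𝓞 K₀) (𝓞 K) b := by
      rw [hpoly]
      simp only [pow_two, Polynomial.derivative_mul,
        Polynomial.derivative_X, Polynomial.derivative_C, map_add, map_mul, map_one, map_zero,
        Polynomial.aeval_X, Polynomial.aeval_C]
      ring
    have h' := congrArg (fun y : 𝓞 K => τ (y : K)) h
    simp only [map_add, map_mul, map_ofNat] at h'
    exact h'
  rw [hder]
  have him' := congrArg Complex.im hroot
  simp only [Complex.add_im, Complex.mul_im, pow_two, hreal, Complex.zero_im] at him'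
  have hb : (τ (algebraMap K₀ K b)).re = -2 * (τ α).re := by
    apply mul_right_cancel₀ him
    linarith
  have heq : 2 * τ α + τ (algebraMap K₀ K b) = ((2 * (τ α).im : ℝ) : ℂ) * Complex.I := by
    apply Complex.ext
    · simp [hb]
    · simp [hreal]
  rw [heq, norm_mul, Complex.norm_I, mul_one, Complex.norm_real, Real.norm_eq_abs, abs_mul,
    abs_two]
  gcongr
  exact Complex.abs_im_le_norm _

theorem natCast_absNorm_span_eq_prod_embeddings (β : 𝓞 K) :
    (Ideal.absNorm (Ideal.span {β}) : ℝ) = ∏ τ : K →ₐ[ℚ] ℂ, ‖τ β‖ := by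
  rw [Ideal.absNorm_span_singleton, ← norm_prod, ← Algebra.norm_eq_prod_embeddings,
    ← Algebra.coe_norm_int]
  simp [Nat.cast_natAbs]

/-- If `α` generates the CM-field `K` over `K₀`, then `Δ_K ≤ 2^[K:ℚ] · |N α| · Δ_{K₀}²`. -/
theorem natAbs_discr_le_of_notMem_range (hTR : ∀ ψ : K₀ →+* ℂ, ∀ z : K₀, (ψ z).im = 0)
    (h2 : Module.finrank K₀ K = 2) (hK : IsEmpty (K →+* ℝ)) {α : 𝓞 K}
    (hα : (α : K) ∉ (algebraMap K₀ K).range) :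
    ((discr K).natAbs : ℝ) ≤ 2 ^ Module.finrank ℚ K * Ideal.absNorm (Ideal.span {α}) *
      (discr K₀).natAbs ^ 2 := by
  have htop := adjoin_singleton_eq_top_of_finrank_eq_two h2 hα
  set β : 𝓞 K := Polynomial.aeval α (Polynomial.derivative (minpoly (𝓞 K₀) α)) with hβ
  have hmem : β ∈ differentIdeal (𝓞 K₀) (𝓞 K) := by
    exact aeval_derivative_mem_differentIdeal (𝓞 K₀) K₀ K α htop
  have hβ0 : β ≠ 0 := by
    intro h0
    have hint : IsIntegral (𝓞 K₀) α := Algebra.IsIntegral.isIntegral α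
    have hsep : (minpoly K₀ (α : K)).Separable := Algebra.IsSeparable.isSeparable K₀ (α : K)
    have h1 := hsep.aeval_derivative_ne_zero (minpoly.aeval K₀ (α : K))
    apply h1
    rw [show (α : K) = algebraMap (𝓞 K) K α from rfl,
      minpoly.isIntegrallyClosed_eq_field_fractions K₀ K hint, Polynomial.derivative_map,
      Polynomial.aeval_map_algebraMap, Polynomial.aeval_algebraMap_apply, ← hβ, h0, map_zero]
  have hle : (Ideal.absNorm (differentIdeal (𝓞 K₀) (𝓞 K)) : ℝ) ≤
      Ideal.absNorm (Ideal.span {β}) := by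
    rw [Nat.cast_le]
    refine Nat.le_of_dvd (Nat.pos_of_ne_zero ?_) (Ideal.absNorm_dvd_absNorm_of_le ?_)
    · rw [Ne, Ideal.absNorm_eq_zero_iff, Ideal.span_singleton_eq_bot]
      exact hβ0
    · rwa [Ideal.span_singleton_le_iff_mem]
  have hprod : (Ideal.absNorm (Ideal.span {β}) : ℝ) ≤
      2 ^ Module.finrank ℚ K * Ideal.absNorm (Ideal.span {α}) := by
    rw [natCast_absNorm_span_eq_prod_embeddings, natCast_absNorm_span_eq_prod_embeddings,
      ← AlgHom.card ℚ K ℂ, ← Finset.card_univ, ← Finset.prod_const, ← Finset.prod_mul_distrib]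
    exact Finset.prod_le_prod (fun _ _ => norm_nonneg _) fun τ _ =>
      norm_derivative_minpoly_le hTR h2 hK hα τ.toRingHom
  rw [natAbs_discr_eq_absNorm_differentIdeal_mul_natAbs_discr_pow K₀ (𝓞 K₀) K (𝓞 K), h2]
  push_cast
  gcongr
  exact hle.trans hprod

end Discriminant

section LocalSums

theorem norm_tsum_subtype_le_of_geometric {g : ℕ → ℂ} {B r : ℝ} (hr0 : 0 ≤ r) (hr : r ≤ 1 / 2)
    (hg : ∀ m, ‖g m‖ ≤ B * r ^ m) {k : ℕ} {P : ℕ → Prop} (hP : ∀ m, P m → k ≤ m) :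
    ‖∑' m : {m // P m}, g m‖ ≤ 2 * B * r ^ k := by
  have hB : 0 ≤ B := by simpa using (norm_nonneg _).trans (hg 0)
  set f : ℕ → ℂ := Set.indicator {m | P m} g with hf
  have hfg : ∀ m, ‖f m‖ ≤ B * r ^ m := fun m => (norm_indicator_le_norm_self _ _).trans (hg m)
  have hgeom : Summable fun m : ℕ => B * r ^ m :=
    (summable_geometric_of_lt_one hr0 (by linarith)).mul_left B
  have hsum : Summable f := .of_norm_bounded hgeom hfg
  have hzero : ∑ i ∈ Finset.range k, f i = 0 := by
    refine Finset.sum_eq_zero fun i hi => Set.indicator_of_notMem (fun h => ?_) _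
    exact absurd (hP i h) (by simpa using hi)
  have heq : ∑' m : {m // P m}, g m = ∑' m, f (m + k) := by
    rw [← zero_add (∑' m, f (m + k)), ← hzero, hsum.sum_add_tsum_nat_add k]
    exact tsum_subtype {m | P m} g
  have hgeom' : HasSum (fun m : ℕ => B * r ^ k * r ^ m) (B * r ^ k * (1 - r)⁻¹) :=
    (hasSum_geometric_of_lt_one hr0 (by linarith)).mul_left _
  rw [heq]
  refine (tsum_of_norm_bounded hgeom' fun m => (hfg _).trans_eq (by ring)).trans ?_
  have : (1 - r)⁻¹ ≤ 2 := by
    rw [inv_le_comm₀ (by linarith) two_pos]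
    linarith
  calc B * r ^ k * (1 - r)⁻¹ ≤ B * r ^ k * 2 := by gcongr
    _ = 2 * B * r ^ k := by ring

theorem natCast_sq_rpow_half (p m : ℕ) :
    (((p ^ 2 : ℕ) : ℝ) ^ ((m : ℝ) / 2)) = (p : ℝ) ^ m := by
  rw [Nat.cast_pow, ← Real.rpow_natCast (p : ℝ) 2, ← Real.rpow_mul (Nat.cast_nonneg p),
    ← Real.rpow_natCast]
  congr 1
  push_cast
  ring

/-- The inner sum `∑_{m ≥ 1, (m, h) = 1} ψ(m·log n/L)/n^{m/2}`. -/
noncomputable def coprimePowerSum (ψ : ℝ → ℂ) (h : ℕ) (L : ℝ) (n : ℕ) : ℂ :=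
  ∑' m : {m : ℕ // 1 ≤ m ∧ Nat.Coprime m h},
    ψ ((m : ℝ) * Real.log n / L) / ((((n : ℝ) ^ (((m : ℕ) : ℝ) / 2)) : ℝ) : ℂ)

theorem norm_primePower_term_le {ψ : ℝ → ℂ} {B : ℝ} (hB : ∀ x, ‖ψ x‖ ≤ B) (p m : ℕ) (x : ℝ) :
    ‖ψ x / ((((p ^ 2 : ℕ) : ℝ) ^ ((m : ℝ) / 2) : ℝ) : ℂ)‖ ≤ B * ((p : ℝ)⁻¹) ^ m := by
  rw [natCast_sq_rpow_half, norm_div, Complex.norm_real, Real.norm_of_nonneg (by positivity),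
    div_eq_mul_inv, inv_pow]
  gcongr
  exact hB _

theorem natCast_prime_inv_le_half {p : ℕ} (hp : p.Prime) : (p : ℝ)⁻¹ ≤ 1 / 2 := by
  rw [one_div]
  gcongr
  exact_mod_cast hp.two_le

theorem norm_coprimePowerSum_le {ψ : ℝ → ℂ} {B : ℝ} (hB : ∀ x, ‖ψ x‖ ≤ B) {p : ℕ}
    (hp : p.Prime) (h : ℕ) (L : ℝ) :
    ‖coprimePowerSum ψ h L (p ^ 2)‖ ≤ 2 * B * (p : ℝ)⁻¹ := by
  have := norm_tsum_subtype_le_of_geometric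
    (g := fun m : ℕ => ψ ((m : ℝ) * Real.log (p ^ 2 : ℕ) / L) /
      ((((p ^ 2 : ℕ) : ℝ) ^ ((m : ℝ) / 2) : ℝ) : ℂ))
    (by positivity) (natCast_prime_inv_le_half hp) (fun m => norm_primePower_term_le hB p m _)
    (k := 1) (P := fun m => 1 ≤ m ∧ Nat.Coprime m h) fun m hm => hm.1
  rw [pow_one] at this
  exact this

theorem norm_coprimePowerSum_sub_le {ψ : ℝ → ℂ} {B : ℝ} (hB : ∀ x, ‖ψ x‖ ≤ B) {p : ℕ}
    (hp : p.Prime) (h : ℕ) (L : ℝ) :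
    ‖coprimePowerSum ψ h L (p ^ 2) - ψ (2 * Real.log p / L) / p‖ ≤ 2 * B * (p : ℝ)⁻¹ ^ 2 := by
  set g : ℕ → ℂ := fun m : ℕ => ψ ((m : ℝ) * Real.log (p ^ 2 : ℕ) / L) /
      ((((p ^ 2 : ℕ) : ℝ) ^ ((m : ℝ) / 2) : ℝ) : ℂ) with hg
  have hbound : ∀ m, ‖g m‖ ≤ B * ((p : ℝ)⁻¹) ^ m := fun m => norm_primePower_term_le hB p m _
  have hr := natCast_prime_inv_le_half hp
  have hsum : Summable g := .of_norm_bounded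
    ((summable_geometric_of_lt_one (by positivity) (by linarith)).mul_left B) hbound
  have hg1 : g 1 = ψ (2 * Real.log p / L) / p := by
    rw [hg]
    simp only [natCast_sq_rpow_half]
    simp [Real.log_pow]
  have hsplit : coprimePowerSum ψ h L (p ^ 2) =
      g 1 + ∑' m : {m : ℕ // 2 ≤ m ∧ Nat.Coprime m h}, g m := by
    have h1 : coprimePowerSum ψ h L (p ^ 2) =
        ∑' m, Set.indicator {m | 1 ≤ m ∧ Nat.Coprime m h} g m :=
      tsum_subtype {m | 1 ≤ m ∧ Nat.Coprime m h} g
    have h2 : ∑' m : {m : ℕ // 2 ≤ m ∧ Nat.Coprime m h}, g m =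
        ∑' m, Set.indicator {m | 2 ≤ m ∧ Nat.Coprime m h} g m :=
      tsum_subtype {m | 2 ≤ m ∧ Nat.Coprime m h} g
    rw [h1, h2, (hsum.indicator _).tsum_eq_add_tsum_ite 1,
      Set.indicator_of_mem (show 1 ∈ {m | 1 ≤ m ∧ Nat.Coprime m h} by simp)]
    congr 1
    refine tsum_congr fun m => ?_
    by_cases hm : m = 1
    · simp [hm]
    · have hiff : 1 ≤ m ↔ 2 ≤ m := by omega
      simp [hm, Set.indicator_apply, hiff]
  rw [hsplit, hg1, add_sub_cancel_left]
  exact norm_tsum_subtype_le_of_geometric (by positivity) hr hbound fun m hm => hm.1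

theorem eq_zero_of_support_subset_Ioo {ψ : ℝ → ℂ} {σ : ℝ} (hψ : Function.support ψ ⊆ Set.Ioo (-σ) σ)
    {x : ℝ} (hx : σ ≤ x) : ψ x = 0 := by
  by_contra h
  exact absurd (hψ h).2 hx.not_gt

theorem coprimePowerSum_eq_zero {ψ : ℝ → ℂ} {σ : ℝ}
    (hψ : Function.support ψ ⊆ Set.Ioo (-σ) σ) (h : ℕ) {L : ℝ} (hL : 0 < L) {n : ℕ}
    (hn : σ * L ≤ Real.log n) : coprimePowerSum ψ h L n = 0 := by
  rw [coprimePowerSum, ← tsum_zero]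
  refine tsum_congr fun m => ?_
  rw [eq_zero_of_support_subset_Ioo hψ, zero_div]
  rw [le_div_iff₀ hL]
  have hm : (1 : ℝ) ≤ (m : ℕ) := by exact_mod_cast m.2.1
  nlinarith [Real.log_natCast_nonneg n]

end LocalSums

section Primes

theorem map_injective_of_isPrime {K₀ K : Type*} [Field K₀] [NumberField K₀] [Field K]
    [Algebra K₀ K] {I J : Ideal (𝓞 K₀)} (hI : I.IsPrime) (hJ : J.IsPrime)
    (hI0 : I ≠ ⊥) (hJ0 : J ≠ ⊥)
    (hmap : (I.map (algebraMap (𝓞 K₀) (𝓞 K))).IsPrime)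
    (h : I.map (algebraMap (𝓞 K₀) (𝓞 K)) = J.map (algebraMap (𝓞 K₀) (𝓞 K))) : I = J := by
  have hmaxI := hI.isMaximal hI0
  have hmaxJ := hJ.isMaximal hJ0
  have hne : (I.map (algebraMap (𝓞 K₀) (𝓞 K))).comap (algebraMap (𝓞 K₀) (𝓞 K)) ≠ ⊤ :=
    (Ideal.comap_isPrime _ _).ne_top
  rw [hmaxI.eq_of_le hne Ideal.le_comap_map]
  symm
  refine hmaxJ.eq_of_le hne ?_
  rw [h]
  exact Ideal.le_comap_map

variable {K₀ K : Type*} [Field K₀] [NumberField K₀] [Field K] [NumberField K] [Algebra K₀ K]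

theorem finite_subtype_log_absNorm_lt (L : Type*) [Field L] [NumberField L]
    (P : Ideal (𝓞 L) → Prop) (hP : ∀ I, P I → I ≠ ⊥) (x : ℝ) :
    {I : {I // P I} | Real.log (Ideal.absNorm I.1) < x}.Finite := by
  refine Set.Finite.of_finite_image (f := Subtype.val) ?_ Subtype.val_injective.injOn
  refine (Ideal.finite_setOfPred_absNorm_le ⌈Real.exp x⌉₊).subset ?_
  rintro _ ⟨I, hI, rfl⟩
  have hpos : (0 : ℝ) < Ideal.absNorm I.1 := by
    exact_mod_cast Nat.pos_of_ne_zero (Ideal.absNorm_eq_zero_iff.not.2 (hP _ I.2))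
  have : (Ideal.absNorm I.1 : ℝ) ≤ ⌈Real.exp x⌉₊ :=
    ((Real.log_lt_iff_lt_exp hpos).1 hI).le.trans (Nat.le_ceil _)
  exact_mod_cast this

/-- A principal prime of `𝓞 K` whose norm is the square of a rational prime either is extended
from a prime of `𝓞 K₀` of prime norm, or has a norm bounded below in terms of `Δ_K`. -/
theorem exists_map_eq_or_natAbs_discr_le (hTR : ∀ ψ : K₀ →+* ℂ, ∀ z : K₀, (ψ z).im = 0)
    (h2 : Module.finrank K₀ K = 2) (hK : IsEmpty (K →+* ℝ)) {𝔭 : Ideal (𝓞 K)}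
    (hprinc : Submodule.IsPrincipal 𝔭) {p : ℕ} (hp : p.Prime)
    (hnorm : Ideal.absNorm 𝔭 = p ^ 2) :
    (∃ 𝔮 : Ideal (𝓞 K₀), 𝔮.IsPrime ∧ (Ideal.absNorm 𝔮).Prime ∧
      𝔮.map (algebraMap (𝓞 K₀) (𝓞 K)) = 𝔭) ∨
    ((discr K).natAbs : ℝ) ≤
      2 ^ Module.finrank ℚ K * (discr K₀).natAbs ^ 2 * (p : ℝ) ^ 2 := by
  obtain ⟨α, hα⟩ := hprinc
  change 𝔭 = Ideal.span {α} at hα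
  by_cases hrange : (α : K) ∈ (algebraMap K₀ K).range
  · left
    obtain ⟨x, hx⟩ := hrange
    have hint : IsIntegral ℤ x := by
      have h : IsIntegral ℤ (algebraMap K₀ K x) := by
        rw [hx]
        exact RingOfIntegers.isIntegral_coe α
      exact (isIntegral_algebraMap_iff (algebraMap K₀ K).injective).1 h
    let y : 𝓞 K₀ := ⟨x, hint⟩
    have hy : algebraMap (𝓞 K₀) (𝓞 K) y = α := RingOfIntegers.ext hx
    have hmap : (Ideal.span {y}).map (algebraMap (𝓞 K₀) (𝓞 K)) = 𝔭 := by
      rw [Ideal.map_span, Set.image_singleton, hy, hα]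
    have hfin : Module.finrank (𝓞 K₀) (𝓞 K) = 2 := by
      rw [← IsFractionRing.finrank_eq (𝓞 K₀) K₀ (𝓞 K) K, h2]
    have hN : Ideal.absNorm (Ideal.span {y}) = p := by
      have := Ideal.absNorm_algebraMap (R := 𝓞 K₀) (S := 𝓞 K) (Ideal.span {y})
      rw [hmap, hnorm, hfin] at this
      exact (Nat.pow_left_injective two_ne_zero this).symm
    exact ⟨_, Ideal.isPrime_of_irreducible_absNorm (by rw [hN]; exact hp), by rw [hN]; exact hp,
      hmap⟩
  · right
    have := natAbs_discr_le_of_notMem_range hTR h2 hK hrange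
    rw [← hα, hnorm] at this
    push_cast at this
    linarith

end Primes

theorem norm_tsum_le_of_sum_norm_le {ι : Type*} {f : ι → ℂ} {c : ℝ}
    (h : ∀ T : Finset ι, ∑ i ∈ T, ‖f i‖ ≤ c) : ‖∑' i, f i‖ ≤ c := by
  have hs : Summable fun i => ‖f i‖ := summable_of_sum_le (fun _ => norm_nonneg _) h
  exact (norm_tsum_le_tsum_norm hs).trans (hs.tsum_le_of_sum_le h)

theorem tsum_add_mul_tsum_eq {ι κ : Type*} {e : κ → ι} (he : Function.Injective e)
    {F : ι → ℂ} {G : κ → ℂ} (hF : Summable F) (hG : Summable G) :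
    -2 * ∑' i, F i + 4 * ∑' j, G j =
      -2 * (∑' j, (F (e j) - 2 * G j) + ∑' i : ((Set.range e)ᶜ : Set ι), F i) := by
  have hFe : Summable fun j => F (e j) := hF.comp_injective he
  have hsplit : ∑' j, F (e j) + ∑' i : ((Set.range e)ᶜ : Set ι), F i = ∑' i, F i := by
    rw [← tsum_range F he]
    exact (hF.subtype (Set.range e)).tsum_add_tsum_compl (hF.subtype _)
  rw [hFe.tsum_sub (hG.mul_left 2), tsum_mul_left, ← hsplit]
  ring

theorem summable_log_div_sq (B : ℝ) :
    Summable fun n : ℕ => 4 * B * (Real.log n * (n : ℝ)⁻¹ ^ 2) := by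
  refine Summable.mul_left _ ?_
  have h : Summable fun n : ℕ => 2 * (1 / (n : ℝ) ^ (3 / 2 : ℝ)) :=
    (Real.summable_one_div_nat_rpow.2 (by norm_num)).mul_left 2
  refine h.of_nonneg_of_le (fun n => mul_nonneg (Real.log_natCast_nonneg n) (by positivity))
    fun n => ?_
  rcases Nat.eq_zero_or_pos n with rfl | hn
  · simp
  have hn' : (0 : ℝ) < n := by exact_mod_cast hn
  have hlog := Real.log_le_rpow_div hn'.le (show (0 : ℝ) < 1 / 2 by norm_num)
  have hpow : (n : ℝ) ^ (1 / 2 : ℝ) * (n : ℝ) ^ (3 / 2 : ℝ) = (n : ℝ) ^ 2 := by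
    rw [← Real.rpow_add hn', ← Real.rpow_natCast]
    norm_num
  have h32 : (0 : ℝ) < (n : ℝ) ^ (3 / 2 : ℝ) := by positivity
  calc Real.log n * (n : ℝ)⁻¹ ^ 2 ≤ (n : ℝ) ^ (1 / 2 : ℝ) / (1 / 2) * (n : ℝ)⁻¹ ^ 2 := by gcongr
    _ = 2 * (1 / (n : ℝ) ^ (3 / 2 : ℝ)) := by
        rw [inv_pow, ← hpow]
        field_simp

theorem one_le_log_log {x : ℝ} (hx : 16 ≤ x) : 1 ≤ Real.log (Real.log x) := by
  have h16 : Real.log 16 = 4 * Real.log 2 := by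
    rw [show (16 : ℝ) = 2 ^ 4 by norm_num, Real.log_pow]
    norm_num
  have he : Real.exp 1 ≤ Real.log x := by
    have := Real.log_le_log (by norm_num) hx
    linarith [Real.exp_one_lt_d9, Real.log_two_gt_d9]
  exact (Real.le_log_iff_exp_le ((Real.exp_pos 1).trans_le he)).2 he

/-- fix a totally real number field `K₀` of class number one and degree `N`,
`0 < σ < 1`, and an even Schwartz function `φ` with `supp(φ̂) ⊆ (−σ, σ)`. There is a
constant `C > 0` (depending only on `K₀` and `φ`) such that for every CM-field `K` with
maximal totally real subfield `K₀` and `Δ_K ≥ 16`,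
`|S_{2,1}(Δ, φ)₂ + 4·∑_𝔮 (log N𝔮/N𝔮)·φ̂(2·log N𝔮/log Δ)| ≤ C·log log Δ`, the last sum
running over the primes `𝔮` of `O_{K₀}` inert in `K` whose absolute norm is a rational
prime. -/
theorem stmt_13.{u, v} (K₀ : Type u) [Field K₀] [NumberField K₀] (N : ℕ)
    (hN : Module.finrank ℚ K₀ = N)
    (hTR : ∀ ψ : K₀ →+* ℂ, ∀ z : K₀, (ψ z).im = 0)
    (hcl : NumberField.classNumber K₀ = 1)
    (σ : ℝ) (hσ0 : 0 < σ) (hσ1 : σ < 1)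
    (φ : SchwartzMap ℝ ℂ) (heven : ∀ x : ℝ, φ (-x) = φ x)
    (hsupp : Function.support (𝓕 ⇑φ) ⊆ Set.Ioo (-σ) σ) :
    ∃ C : ℝ, 0 < C ∧
      ∀ (K : Type v) [Field K] [NumberField K] [Algebra K₀ K],
        Module.finrank K₀ K = 2 →
        IsEmpty (K →+* ℝ) →
        (16 : ℝ) ≤ ((NumberField.discr K).natAbs : ℝ) →
        ‖S21two K φ ((NumberField.discr K).natAbs : ℝ) +
          (4 : ℂ) * ∑' 𝔮 : {𝔮 : Ideal (𝓞 K₀) // 𝔮.IsPrime ∧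
              (Ideal.absNorm 𝔮).Prime ∧
              (Ideal.map (algebraMap (𝓞 K₀) (𝓞 K)) 𝔮).IsPrime},
            ((Real.log (Ideal.absNorm 𝔮.1) / (Ideal.absNorm 𝔮.1 : ℝ) : ℝ) : ℂ) *
              𝓕 ⇑φ (2 * Real.log (Ideal.absNorm 𝔮.1) /
                Real.log ((NumberField.discr K).natAbs : ℝ))‖ ≤
          C * Real.log (Real.log ((NumberField.discr K).natAbs : ℝ)) := by
  obtain ⟨B, hB0, hB⟩ : ∃ B : ℝ, 0 ≤ B ∧ ∀ x, ‖𝓕 ⇑φ x‖ ≤ B :=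
    ⟨∫ x, ‖φ x‖, by positivity,
      fun x => VectorFourier.norm_fourierIntegral_le_integral_norm _ _ _ _ _⟩
  set D : ℝ := 2 ^ (Module.finrank ℚ K₀ * 2) * (discr K₀).natAbs ^ 2
  set X : ℝ := Real.exp (Real.log D / (1 - σ)) with hX
  set w₁ : ℕ → ℝ := fun n => 4 * B * (Real.log n * (n : ℝ)⁻¹ ^ 2) with hw₁
  set w₂ : ℕ → ℝ := fun n => if (n : ℝ) < X then 4 * B else 0 with hw₂
  have hw₁0 : ∀ n, 0 ≤ w₁ n := fun n =>
    mul_nonneg (by positivity) (mul_nonneg (Real.log_natCast_nonneg n) (by positivity))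
  have hw₂0 : ∀ n, 0 ≤ w₂ n := fun n => by
    rw [hw₂]
    dsimp only
    split_ifs <;> positivity
  have hw₁s : Summable w₁ := summable_log_div_sq B
  have hw₂s : Summable w₂ := by
    refine summable_of_hasFiniteSupport ((Set.finite_Iic ⌈X⌉₊).subset fun n hn => ?_)
    have hnX : (n : ℝ) < X := by
      by_contra h
      exact hn (if_neg h)
    have : (n : ℝ) ≤ ⌈X⌉₊ := hnX.le.trans (Nat.le_ceil X)
    exact_mod_cast this
  have hD0 : 0 < D := by
    have : 0 < (discr K₀).natAbs := Int.natAbs_pos.2 (discr_ne_zero K₀)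
    positivity
  set S₁ : ℝ := Module.finrank ℚ K₀ * ∑' n, w₁ n
  set S₂ : ℝ := (Module.finrank ℚ K₀ * 2 : ℕ) * ∑' n, w₂ n
  have hS₁ : 0 ≤ S₁ := mul_nonneg (Nat.cast_nonneg _) (tsum_nonneg hw₁0)
  have hS₂ : 0 ≤ S₂ := mul_nonneg (Nat.cast_nonneg _) (tsum_nonneg hw₂0)
  refine ⟨2 * (S₁ + S₂) + 1, by positivity, ?_⟩
  intro K _ _ _ h2 hKR hΔ
  set Δ : ℝ := ((discr K).natAbs : ℝ)
  have hlogΔ : 0 < Real.log Δ := Real.log_pos (by linarith)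
  have hdeg : Module.finrank ℚ K = Module.finrank ℚ K₀ * 2 := by
    rw [← h2, Module.finrank_mul_finrank]
  have hprinc₀ : ∀ 𝔮 : Ideal (𝓞 K₀), 𝔮.IsPrincipal := by
    have := classNumber_eq_one_iff.1 hcl
    exact IsPrincipalIdealRing.principal
  have hfin : Module.finrank (𝓞 K₀) (𝓞 K) = 2 := by
    rw [← IsFractionRing.finrank_eq (𝓞 K₀) K₀ (𝓞 K) K, h2]
  have hnormmap : ∀ 𝔮 : Ideal (𝓞 K₀),
      Ideal.absNorm (𝔮.map (algebraMap (𝓞 K₀) (𝓞 K))) = Ideal.absNorm 𝔮 ^ 2 := fun 𝔮 => by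
    rw [Ideal.absNorm_algebraMap, hfin]
  let P : Ideal (𝓞 K) → Prop := fun 𝔭 => 𝔭.IsPrime ∧ Submodule.IsPrincipal 𝔭 ∧
      ∃ p : ℕ, p.Prime ∧ Ideal.absNorm 𝔭 = p ^ 2
  let Q : Ideal (𝓞 K₀) → Prop := fun 𝔮 => 𝔮.IsPrime ∧ (Ideal.absNorm 𝔮).Prime ∧
      (Ideal.map (algebraMap (𝓞 K₀) (𝓞 K)) 𝔮).IsPrime
  have hP0 : ∀ 𝔭, P 𝔭 → 𝔭 ≠ ⊥ := by
    rintro 𝔭 ⟨-, -, p, hp, hnorm⟩ rfl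
    rw [Ideal.absNorm_bot] at hnorm
    exact (pow_pos hp.pos 2).ne hnorm
  have hQ0 : ∀ 𝔮, Q 𝔮 → 𝔮 ≠ ⊥ := by
    rintro 𝔮 ⟨-, hp, -⟩ rfl
    rw [Ideal.absNorm_bot] at hp
    exact Nat.not_prime_zero hp
  let e : {𝔮 // Q 𝔮} → {𝔭 // P 𝔭} := fun 𝔮 =>
    ⟨𝔮.1.map (algebraMap (𝓞 K₀) (𝓞 K)), 𝔮.2.2.2, by
      obtain ⟨a, ha⟩ := hprinc₀ 𝔮.1
      refine ⟨algebraMap (𝓞 K₀) (𝓞 K) a, ?_⟩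
      change 𝔮.1 = Ideal.span {a} at ha
      rw [ha, Ideal.map_span, Set.image_singleton], _, 𝔮.2.2.1, hnormmap _⟩
  have he : Function.Injective e := fun 𝔮 𝔮' h => Subtype.ext <|
    map_injective_of_isPrime 𝔮.2.1 𝔮'.2.1 (hQ0 _ 𝔮.2) (hQ0 _ 𝔮'.2) 𝔮.2.2.2
      (congrArg Subtype.val h)
  let F : {𝔭 // P 𝔭} → ℂ := fun 𝔭 => (Real.log (Ideal.absNorm 𝔭.1) : ℂ) *
    coprimePowerSum (𝓕 ⇑φ) (classNumber K) (Real.log Δ) (Ideal.absNorm 𝔭.1)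
  let G : {𝔮 // Q 𝔮} → ℂ := fun 𝔮 =>
    ((Real.log (Ideal.absNorm 𝔮.1) / (Ideal.absNorm 𝔮.1 : ℝ) : ℝ) : ℂ) *
      𝓕 ⇑φ (2 * Real.log (Ideal.absNorm 𝔮.1) / Real.log Δ)
  have hFzero : ∀ 𝔭, σ * Real.log Δ ≤ Real.log (Ideal.absNorm 𝔭.1) → F 𝔭 = 0 := fun 𝔭 h => by
    simp only [F, coprimePowerSum_eq_zero hsupp _ hlogΔ h, mul_zero]
  have hFs : Summable F := by
    refine summable_of_hasFiniteSupport
      ((finite_subtype_log_absNorm_lt K P hP0 (σ * Real.log Δ)).subset fun 𝔭 h𝔭 => ?_)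
    by_contra h
    exact h𝔭 (hFzero 𝔭 (not_lt.1 h))
  have hGs : Summable G := by
    refine summable_of_hasFiniteSupport
      ((finite_subtype_log_absNorm_lt K₀ Q hQ0 (σ * Real.log Δ)).subset fun 𝔮 h𝔮 => ?_)
    by_contra h
    refine h𝔮 ?_
    have h' : σ * Real.log Δ ≤ Real.log (Ideal.absNorm 𝔮.1) := not_lt.1 h
    have hle : σ ≤ 2 * Real.log (Ideal.absNorm 𝔮.1) / Real.log Δ := by
      rw [le_div_iff₀ hlogΔ]
      linarith [Real.log_natCast_nonneg (Ideal.absNorm 𝔮.1)]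
    simp only [G, eq_zero_of_support_subset_Ioo hsupp hle, mul_zero]
  have hinert : ‖∑' 𝔮, (F (e 𝔮) - 2 * G 𝔮)‖ ≤ S₁ := by
    refine norm_tsum_le_of_sum_norm_le fun T => ?_
    refine (Finset.sum_le_sum fun 𝔮 _ => ?_).trans
      (sum_primes_le_finrank_mul_tsum K₀ Subtype.val Subtype.val_injective
        (fun 𝔮 : {𝔮 // Q 𝔮} => Ideal.absNorm 𝔮.1) (fun 𝔮 => 𝔮.2.2.1) (fun 𝔮 => 𝔮.2.1)
        (fun 𝔮 => ⟨1, one_ne_zero, (pow_one _).symm⟩) w₁ hw₁0 hw₁s T)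
    have hq : (Ideal.absNorm 𝔮.1).Prime := 𝔮.2.2.1
    have hF : F (e 𝔮) = (Real.log (Ideal.absNorm 𝔮.1 ^ 2 : ℕ) : ℂ) *
        coprimePowerSum (𝓕 ⇑φ) (classNumber K) (Real.log Δ) (Ideal.absNorm 𝔮.1 ^ 2) := by
      simp only [F, e, hnormmap]
    have hlog := Real.log_natCast_nonneg (Ideal.absNorm 𝔮.1)
    have heq : F (e 𝔮) - 2 * G 𝔮 = ((2 * Real.log (Ideal.absNorm 𝔮.1) : ℝ) : ℂ) *
        (coprimePowerSum (𝓕 ⇑φ) (classNumber K) (Real.log Δ) (Ideal.absNorm 𝔮.1 ^ 2) -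
          𝓕 ⇑φ (2 * Real.log (Ideal.absNorm 𝔮.1) / Real.log Δ) / (Ideal.absNorm 𝔮.1 : ℕ)) := by
      rw [hF, Nat.cast_pow, Real.log_pow]
      simp only [G]
      push_cast
      ring
    rw [heq, norm_mul, Complex.norm_real, Real.norm_of_nonneg (by positivity)]
    calc _ ≤ 2 * Real.log (Ideal.absNorm 𝔮.1) * (2 * B * (Ideal.absNorm 𝔮.1 : ℝ)⁻¹ ^ 2) := by
          gcongr
          exact norm_coprimePowerSum_sub_le hB hq _ _
      _ = w₁ (Ideal.absNorm 𝔮.1) := by rw [hw₁]; ring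
  choose p hp hpn using fun 𝔭 : {𝔭 // P 𝔭} => 𝔭.2.2.2
  have hother : ‖∑' 𝔭 : ((Set.range e)ᶜ : Set {𝔭 // P 𝔭}), F 𝔭‖ ≤ S₂ := by
    refine norm_tsum_le_of_sum_norm_le fun T => ?_
    have hcount := sum_primes_le_finrank_mul_tsum K
      (fun 𝔭 : ((Set.range e)ᶜ : Set {𝔭 // P 𝔭}) => 𝔭.1.1)
      (Subtype.val_injective.comp Subtype.val_injective) (fun 𝔭 => p 𝔭.1) (fun 𝔭 => hp 𝔭.1)
      (fun 𝔭 => 𝔭.1.2.1) (fun 𝔭 => ⟨2, two_ne_zero, hpn 𝔭.1⟩) w₂ hw₂0 hw₂s T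
    rw [hdeg] at hcount
    refine (Finset.sum_le_sum fun 𝔭 _ => ?_).trans hcount
    obtain ⟨𝔭, h𝔭⟩ := 𝔭
    have hp0 : (0 : ℝ) < p 𝔭 := by exact_mod_cast (hp 𝔭).pos
    have hlogN : Real.log (Ideal.absNorm 𝔭.1) = 2 * Real.log (p 𝔭) := by
      rw [hpn, Nat.cast_pow, Real.log_pow]
      norm_num
    by_cases hF : F 𝔭 = 0
    · simp only [hF, norm_zero]
      exact hw₂0 _
    have hlt : 2 * Real.log (p 𝔭) < σ * Real.log Δ := by
      by_contra h
      exact hF (hFzero 𝔭 (hlogN ▸ not_lt.1 h))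
    have hΔle : Δ ≤ D * (p 𝔭 : ℝ) ^ 2 := by
      rcases exists_map_eq_or_natAbs_discr_le hTR h2 hKR 𝔭.2.2.1 (hp 𝔭) (hpn 𝔭) with
        ⟨𝔮, h𝔮, h𝔮p, hmap⟩ | h
      · exact absurd ⟨⟨𝔮, h𝔮, h𝔮p, hmap ▸ 𝔭.2.1⟩, Subtype.ext hmap⟩ h𝔭
      · rwa [hdeg] at h
    have hlogle : Real.log Δ ≤ Real.log D + 2 * Real.log (p 𝔭) := by
      have := Real.log_le_log (by linarith) hΔle
      rw [Real.log_mul hD0.ne' (by positivity), Real.log_pow] at this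
      exact_mod_cast this
    have hpX : (p 𝔭 : ℝ) < X := by
      rw [hX, ← Real.log_lt_iff_lt_exp hp0, lt_div_iff₀ (by linarith)]
      have := Real.log_natCast_nonneg (p 𝔭)
      have hple : Real.log (p 𝔭) ≤ Real.log Δ := by nlinarith
      nlinarith [mul_le_mul_of_nonneg_right hple (sub_nonneg.2 hσ1.le)]
    have hw : w₂ (p 𝔭) = 4 * B := if_pos hpX
    have hlog := Real.log_natCast_nonneg (p 𝔭)
    change ‖F 𝔭‖ ≤ w₂ (p 𝔭)
    rw [hw]
    simp only [F]
    rw [hlogN, hpn, norm_mul, Complex.norm_real, Real.norm_of_nonneg (by positivity)]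
    calc _ ≤ 2 * (p 𝔭 : ℝ) * (2 * B * (p 𝔭 : ℝ)⁻¹) := by
          gcongr
          · exact Real.log_le_self hp0.le
          · exact norm_coprimePowerSum_le hB (hp 𝔭) _ _
      _ = 4 * B := by
          field_simp
          ring
  have hmain : S21two K φ Δ + 4 * ∑' 𝔮, G 𝔮 =
      -2 * (∑' 𝔮, (F (e 𝔮) - 2 * G 𝔮) + ∑' 𝔭 : ((Set.range e)ᶜ : Set {𝔭 // P 𝔭}), F 𝔭) :=
    tsum_add_mul_tsum_eq he hFs hGs
  change ‖S21two K φ Δ + 4 * ∑' 𝔮, G 𝔮‖ ≤ _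
  rw [hmain, norm_mul, norm_neg, Complex.norm_ofNat]
  calc _ ≤ 2 * (S₁ + S₂) := by
        gcongr
        exact (norm_add_le _ _).trans (add_le_add hinert hother)
    _ ≤ (2 * (S₁ + S₂) + 1) * 1 := by linarith
    _ ≤ _ := by
        gcongr
        exact one_le_log_log hΔ
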